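/- arXiv:1412.3613 — 2 statements merged into one kernel-verified Lean document; each statement's English description precedes it below -/
import Mathlib

section
/- Let ℓ ≥ 1, let θ₁, θ₂ ∈ ℝ^ℓ (with the Euclidean norm ‖·‖), let η₁ > η₂ > 0, α > 0, η̂ > 0 be real numbers, and set k = η₁/η₂ (so k > 1). For j = 1, 2 define u_j(x) = exp(−(α/η̂)·‖x − θ_j‖²/η_j). Then for every x ∈ ℝ^ℓ, u₂(x) > u₁(x) holds if and only if ‖x − (k·θ₂ − θ₁)/(k − 1)‖² < (k/(k − 1)²)·‖θ₂ − θ₁‖². -/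
open Real

/-- The algebraic identity behind the Apollonius sphere. -/
lemma norm_smul_sub_sq_sub_mul_norm_sub_sq {E : Type*} [NormedAddCommGroup E]
    [InnerProductSpace ℝ E] (k : ℝ) (a b : E) :
    ‖k • b - a‖ ^ 2 - k * ‖a - b‖ ^ 2 = (k - 1) * (k * ‖b‖ ^ 2 - ‖a‖ ^ 2) := by
  rw [norm_sub_sq_real, norm_sub_sq_real, real_inner_smul_left, norm_smul, mul_pow,
    Real.norm_eq_abs, sq_abs, real_inner_comm]
  ring

/-- The points `x` with `k * ‖x - q‖ ^ 2 < ‖x - p‖ ^ 2` form an open ball when `1 < k`. -/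
lemma norm_sub_smul_sq_lt_iff {E : Type*} [NormedAddCommGroup E] [InnerProductSpace ℝ E]
    {k : ℝ} (hk : 1 < k) (p q x : E) :
    ‖x - (k - 1)⁻¹ • (k • q - p)‖ ^ 2 < k / (k - 1) ^ 2 * ‖q - p‖ ^ 2 ↔
      k * ‖x - q‖ ^ 2 < ‖x - p‖ ^ 2 := by
  have hk' : 0 < k - 1 := sub_pos.mpr hk
  have hcenter : x - (k - 1)⁻¹ • (k • q - p) =
      (k - 1)⁻¹ • (k • (x - q) - (x - p)) := by
    rw [eq_inv_smul_iff₀ hk'.ne', smul_sub, smul_inv_smul₀ hk'.ne']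
    module
  have hid := norm_smul_sub_sq_sub_mul_norm_sub_sq k (x - p) (x - q)
  rw [sub_sub_sub_cancel_left] at hid
  rw [hcenter, norm_smul, mul_pow, Real.norm_eq_abs, sq_abs, inv_pow, div_eq_inv_mul, mul_assoc,
    mul_lt_mul_iff_right₀ (inv_pos.mpr (pow_pos hk' 2)), ← sub_neg, hid,
    ← mul_zero (k - 1),
    mul_lt_mul_iff_right₀ hk', sub_neg]

/-- Proposition 2: with degrees of compatibility
`u_j(x) = exp(−(α/η̂)·‖x − θ_j‖²/η_j)` and `k = η₁/η₂ > 1`, the locus of points with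
`u₂(x) > u₁(x)` is the open ball centered at `(k·θ₂ − θ₁)/(k − 1)` with squared
radius `(k/(k − 1)²)·‖θ₂ − θ₁‖²`. -/
theorem stmt_2 (ℓ : ℕ) (hℓ : 1 ≤ ℓ) (θ₁ θ₂ : EuclideanSpace ℝ (Fin ℓ))
    (η₁ η₂ α ηhat : ℝ) (hη₂ : 0 < η₂) (hη : η₂ < η₁) (hα : 0 < α) (hηhat : 0 < ηhat)
    (k : ℝ) (hk : k = η₁ / η₂)
    (u₁ u₂ : EuclideanSpace ℝ (Fin ℓ) → ℝ)
    (hu₁ : ∀ x, u₁ x = Real.exp (-(α / ηhat) * (‖x - θ₁‖ ^ 2 / η₁)))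
    (hu₂ : ∀ x, u₂ x = Real.exp (-(α / ηhat) * (‖x - θ₂‖ ^ 2 / η₂))) :
    ∀ x : EuclideanSpace ℝ (Fin ℓ),
      u₂ x > u₁ x ↔
        ‖x - (k - 1)⁻¹ • (k • θ₂ - θ₁)‖ ^ 2 < k / (k - 1) ^ 2 * ‖θ₂ - θ₁‖ ^ 2 := by
  intro x
  have hη₁ : 0 < η₁ := hη₂.trans hη
  have hk1 : 1 < k := by rwa [hk, one_lt_div hη₂]
  rw [norm_sub_smul_sq_lt_iff hk1, hu₁, hu₂, gt_iff_lt, Real.exp_lt_exp, neg_mul, neg_mul,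
    neg_lt_neg_iff, mul_lt_mul_iff_right₀ (div_pos hα hηhat), lt_div_iff₀ hη₁, hk,
    div_mul_comm]
end

section
/- Let σ > 0 and γ > 0, and let p be the density of the one-dimensional Gaussian distribution N(0, σ²). Define f : ℝ → ℝ by f(θ) = (∫_ℝ x·exp(−(x − θ)²/γ)·p(x) dx) / (∫_ℝ exp(−(x − θ)²/γ)·p(x) dx). Then f(0) = 0, f is differentiable at 0 with f'(0) = 2σ²/(2σ² + γ), and 0 < 2σ²/(2σ² + γ) < 1. Hence 0 is a stable fixed point of the iteration θ^{t+1} = f(θ^t). -/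
open Real MeasureTheory

/-- The first moment of a Gaussian weight centred at `c` is `c` times its mass. -/
theorem integral_id_mul_exp_neg_mul_sub_sq {b : ℝ} (hb : 0 < b) (c : ℝ) :
    ∫ x : ℝ, x * exp (-b * (x - c) ^ 2) = c * ∫ x : ℝ, exp (-b * (x - c) ^ 2) := by
  have odd_integral : ∫ x : ℝ, x * exp (-b * x ^ 2) = 0 := by
    have h := integral_neg_eq_self (fun x : ℝ ↦ x * exp (-b * x ^ 2)) volume
    simp only [neg_sq, neg_mul, integral_neg] at h ⊢
    linarith
  calc ∫ x : ℝ, x * exp (-b * (x - c) ^ 2)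
      = ∫ x : ℝ, (x + c) * exp (-b * x ^ 2) := by
        rw [← integral_sub_right_eq_self (fun x : ℝ ↦ (x + c) * exp (-b * x ^ 2)) c]
        simp only [sub_add_cancel]
    _ = c * ∫ x : ℝ, exp (-b * x ^ 2) := by
        simp only [add_mul]
        rw [integral_add (integrable_mul_exp_neg_mul_sq hb)
          ((integrable_exp_neg_mul_sq hb).const_mul c), odd_integral, zero_add,
          integral_const_mul]
    _ = c * ∫ x : ℝ, exp (-b * (x - c) ^ 2) := by
        rw [integral_sub_right_eq_self (fun x : ℝ ↦ exp (-b * x ^ 2)) c]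

/-- Completing the square in the product of two Gaussian weights. -/
theorem exp_neg_sub_sq_div_mul_exp_neg_sq_div {σ γ : ℝ} (hσ : 0 < σ) (hγ : 0 < γ) (x θ : ℝ) :
    exp (-(x - θ) ^ 2 / γ) * exp (-x ^ 2 / (2 * σ ^ 2)) =
      exp (-θ ^ 2 / (2 * σ ^ 2 + γ)) *
        exp (-(1 / γ + 1 / (2 * σ ^ 2)) * (x - 2 * σ ^ 2 / (2 * σ ^ 2 + γ) * θ) ^ 2) := by
  have : 2 * σ ^ 2 + γ ≠ 0 := by positivity
  rw [← exp_add, ← exp_add]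
  congr 1
  field_simp
  ring

/-- Proposition 4 (one-dimensional content): for a centered Gaussian density `p` of
variance `σ²`, the APCM update map `f` has `f(0) = 0`, is differentiable at `0` with
`f'(0) = 2σ²/(2σ² + γ)`, and this derivative lies strictly between `0` and `1`;
hence `0` is a stable fixed point of the iteration `θ ↦ f(θ)`. -/
theorem stmt_5 (σ γ : ℝ) (hσ : 0 < σ) (hγ : 0 < γ)
    (p : ℝ → ℝ)
    (hp : ∀ x, p x = (1 / (σ * Real.sqrt (2 * Real.pi))) * Real.exp (-x ^ 2 / (2 * σ ^ 2)))
    (f : ℝ → ℝ)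
    (hf : ∀ θ, f θ =
      (∫ x : ℝ, x * Real.exp (-(x - θ) ^ 2 / γ) * p x) /
        (∫ x : ℝ, Real.exp (-(x - θ) ^ 2 / γ) * p x)) :
    f 0 = 0 ∧
    HasDerivAt f (2 * σ ^ 2 / (2 * σ ^ 2 + γ)) 0 ∧
    0 < 2 * σ ^ 2 / (2 * σ ^ 2 + γ) ∧
    2 * σ ^ 2 / (2 * σ ^ 2 + γ) < 1 := by
  set m := 2 * σ ^ 2 / (2 * σ ^ 2 + γ) with hm
  set b := 1 / γ + 1 / (2 * σ ^ 2)
  have hb : 0 < b := by positivity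
  have f_eq (θ : ℝ) : f θ = m * θ := by
    set K := 1 / (σ * √(2 * π)) * exp (-θ ^ 2 / (2 * σ ^ 2 + γ))
    have hK : K ≠ 0 := by positivity
    have weight_eq (x : ℝ) :
        exp (-(x - θ) ^ 2 / γ) * p x = K * exp (-b * (x - m * θ) ^ 2) := by
      rw [hp, mul_left_comm, exp_neg_sub_sq_div_mul_exp_neg_sq_div hσ hγ, ← mul_assoc]
    have mass_pos : 0 < ∫ x : ℝ, exp (-b * (x - m * θ) ^ 2) := by
      rw [integral_sub_right_eq_self (fun x : ℝ ↦ exp (-b * x ^ 2)), integral_gaussian]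
      positivity
    simp only [hf, mul_assoc, weight_eq, mul_left_comm _ K]
    rw [integral_const_mul, integral_const_mul, integral_id_mul_exp_neg_mul_sub_sq hb,
      mul_div_mul_left _ _ hK, mul_div_cancel_right₀ _ mass_pos.ne']
  refine ⟨by simp [f_eq], ?_, by positivity, ?_⟩
  · rw [funext f_eq]
    simpa using (hasDerivAt_id (0 : ℝ)).const_mul m
  · rw [hm, div_lt_one (by positivity)]
    linarith
end
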